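/- arXiv:2405.06898 — 4 statements merged into one kernel-verified Lean document; each statement's English description precedes it below -/
import Mathlib

section
/- Let N ≥ 1 be an integer, let t ≥ p > 1, and let α, β, γ ∈ ℝ satisfy tγ = α + (t−1)β + 1. Then for every radial function u ∈ C_c^∞(ℝ^N∖{0}), one has (∫ |Δu|^p / |x|^{pα} dx)^{1/p} · (∫ |∇u|^{p(t−1)/(p−1)} / |x|^{(p(t−1)/(p−1))β} dx)^{(p−1)/p} ≥ (|N − t(N+γ−1)| / t) · ∫ |∇u|^t / |x|^{tγ} dx. -/
open MeasureTheory Real RealInnerProductSpace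

noncomputable section

/-- The Laplacian of `u : ℝ^N → ℝ`, as the sum of the second partial derivatives. -/
def lap {N : ℕ} (u : EuclideanSpace ℝ (Fin N) → ℝ) (x : EuclideanSpace ℝ (Fin N)) : ℝ :=
  ∑ i : Fin N, fderiv ℝ (fun y => fderiv ℝ u y (EuclideanSpace.single i 1)) x
    (EuclideanSpace.single i 1)

/-- Smooth compactly supported functions on `ℝ^N` with support avoiding the origin,
i.e. `u ∈ C_c^∞(ℝ^N \ {0})`. -/
def IsTestFn {N : ℕ} (u : EuclideanSpace ℝ (Fin N) → ℝ) : Prop :=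
  ContDiff ℝ (⊤ : ℕ∞) u ∧ HasCompactSupport u ∧ (0 : EuclideanSpace ℝ (Fin N)) ∉ tsupport u

/-- A function on `ℝ^N` is radial if its value depends only on the norm. -/
def IsRadial {N : ℕ} (u : EuclideanSpace ℝ (Fin N) → ℝ) : Prop :=
  ∀ x y : EuclideanSpace ℝ (Fin N), ‖x‖ = ‖y‖ → u x = u y

/-- `∫ |Δu|^p / |x|^w dx` over `ℝ^N`. -/
def lapInt {N : ℕ} (p w : ℝ) (u : EuclideanSpace ℝ (Fin N) → ℝ) : ℝ :=
  ∫ x : EuclideanSpace ℝ (Fin N), |lap u x| ^ p / ‖x‖ ^ w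

/-- `∫ |∇u|^q / |x|^w dx` over `ℝ^N`. -/
def gradInt {N : ℕ} (q w : ℝ) (u : EuclideanSpace ℝ (Fin N) → ℝ) : ℝ :=
  ∫ x : EuclideanSpace ℝ (Fin N), ‖gradient u x‖ ^ q / ‖x‖ ^ w

open Function

/-- Multiplying by a function that is only smooth away from the origin preserves smoothness, when
the support stays away from the origin. -/
theorem ContDiff.mul_of_support_subset {E : Type*} [NormedAddCommGroup E] [NormedSpace ℝ E]
    {n : WithTop ℕ∞} {f g : E → ℝ} {K : Set E} (hK : IsClosed K) (h0 : (0 : E) ∉ K)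
    (hf : ContDiff ℝ n f) (hfK : support f ⊆ K) (hg : ∀ x ≠ 0, ContDiffAt ℝ n g x) :
    ContDiff ℝ n (fun x => f x * g x) := by
  rw [contDiff_iff_contDiffAt]
  intro x
  by_cases hx : x = 0
  · subst hx
    have : (fun x => f x * g x) =ᶠ[nhds 0] fun _ => 0 := by
      filter_upwards [hK.isOpen_compl.mem_nhds h0] with y hy
      have : f y = 0 := by
        by_contra h
        exact hy (hfK h)
      simp [this]
    exact contDiffAt_const.congr_of_eventuallyEq this
  · exact hf.contDiffAt.mul (hg x hx)

theorem contDiffAt_norm_rpow_of_ne {E : Type*} [NormedAddCommGroup E] [InnerProductSpace ℝ E]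
    {n : WithTop ℕ∞} {x : E} (hx : x ≠ 0) (s : ℝ) : ContDiffAt ℝ n (fun y : E => ‖y‖ ^ s) x :=
  (contDiffAt_norm ℝ hx).rpow_const_of_ne (norm_ne_zero_iff.mpr hx)

/-- The differential of a radial function only sees the radial direction. -/
theorem IsRadial.fderiv_apply {N : ℕ} {u : EuclideanSpace ℝ (Fin N) → ℝ} (hrad : IsRadial u)
    (hu : Differentiable ℝ u) {x : EuclideanSpace ℝ (Fin N)}
    (z : EuclideanSpace ℝ (Fin N)) :
    fderiv ℝ u x z = fderiv ℝ u x x * (‖x‖ ^ 2)⁻¹ * inner ℝ x z := by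
  set R := (Submodule.span ℝ {x}).reflection
  have hcomp : u ∘ R = u := by
    ext y
    exact hrad _ _ (R.norm_map y)
  have hRx : R x = x :=
    Submodule.reflection_mem_subspace_eq_self (Submodule.mem_span_singleton_self x)
  have h1 : fderiv ℝ u x z = fderiv ℝ u x (R z) := by
    have h2 : HasFDerivAt (u ∘ R) ((fderiv ℝ u (R x)).comp
        (R.toContinuousLinearEquiv : EuclideanSpace ℝ (Fin N) →L[ℝ] EuclideanSpace ℝ (Fin N))) x :=
      (hu (R x)).hasFDerivAt.comp x R.toContinuousLinearEquiv.hasFDerivAt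
    rw [hcomp, hRx] at h2
    have h3 := congrArg (fun L => L z) h2.fderiv
    simpa using h3
  have h4 : R z = (2 * (inner ℝ x z / ‖x‖ ^ 2)) • x - z := by
    have := Submodule.reflection_singleton_apply (𝕜 := ℝ) x z
    rw [show R z = _ from this, mul_smul]
    simp [two_smul]
  rw [h4, map_sub, map_smul, smul_eq_mul] at h1
  rw [div_eq_mul_inv] at h1
  linarith

/-- The coefficient `k` in `∇u(x) = k(x) x` for radial `u`. -/
def radialCoeff {N : ℕ} (u : EuclideanSpace ℝ (Fin N) → ℝ) (x : EuclideanSpace ℝ (Fin N)) : ℝ :=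
  fderiv ℝ u x x * (‖x‖ ^ 2)⁻¹

theorem radialCoeff_zero {N : ℕ} (u : EuclideanSpace ℝ (Fin N) → ℝ) : radialCoeff u 0 = 0 := by
  simp [radialCoeff]

theorem support_radialCoeff_subset {N : ℕ} (u : EuclideanSpace ℝ (Fin N) → ℝ) :
    support (radialCoeff u) ⊆ tsupport u := by
  intro x hx
  refine support_fderiv_subset ℝ (f := u) ?_
  intro h
  exact hx (by simp [radialCoeff, h])

theorem IsTestFn.contDiff_radialCoeff {N : ℕ} {u : EuclideanSpace ℝ (Fin N) → ℝ}
    (hu : IsTestFn u) : ContDiff ℝ (⊤ : ℕ∞) (radialCoeff u) := by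
  obtain ⟨h1, h2, h3⟩ := hu
  refine ContDiff.mul_of_support_subset (isClosed_tsupport u) h3 ?_ ?_ ?_
  · exact (h1.fderiv_right (m := (⊤ : ℕ∞)) (by simp)).clm_apply contDiff_id
  · intro x hx
    refine support_fderiv_subset ℝ (f := u) ?_
    intro h
    exact hx (by simp [h])
  · intro x hx
    exact ((contDiff_norm_sq ℝ).contDiffAt).inv (by simpa using hx)

theorem IsTestFn.fderiv_eq_radialCoeff {N : ℕ} {u : EuclideanSpace ℝ (Fin N) → ℝ}
    (hu : IsTestFn u) (hrad : IsRadial u) (x z : EuclideanSpace ℝ (Fin N)) :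
    fderiv ℝ u x z = radialCoeff u x * inner ℝ x z :=
  hrad.fderiv_apply (hu.1.differentiable (by simp)) z

theorem IsTestFn.norm_gradient {N : ℕ} {u : EuclideanSpace ℝ (Fin N) → ℝ}
    (hu : IsTestFn u) (hrad : IsRadial u) (x : EuclideanSpace ℝ (Fin N)) :
    ‖gradient u x‖ = |radialCoeff u x| * ‖x‖ := by
  have : gradient u x = radialCoeff u x • x := by
    refine ext_inner_right ℝ fun z => ?_
    rw [gradient, InnerProductSpace.toDual_symm_apply, hu.fderiv_eq_radialCoeff hrad,
      real_inner_smul_left]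
  rw [this, norm_smul, Real.norm_eq_abs]

theorem EuclideanSpace.sum_apply_mul_eq {N : ℕ} (L : EuclideanSpace ℝ (Fin N) →L[ℝ] ℝ)
    (x : EuclideanSpace ℝ (Fin N)) :
    ∑ i, L (EuclideanSpace.single i 1) * x i = L x := by
  conv_rhs => rw [← (EuclideanSpace.basisFun (Fin N) ℝ).sum_repr x]
  simp [mul_comm]

theorem IsTestFn.lap_eq {N : ℕ} {u : EuclideanSpace ℝ (Fin N) → ℝ}
    (hu : IsTestFn u) (hrad : IsRadial u) (x : EuclideanSpace ℝ (Fin N)) :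
    lap u x = N * radialCoeff u x + fderiv ℝ (radialCoeff u) x x := by
  have hd : DifferentiableAt ℝ (radialCoeff u) x :=
    hu.contDiff_radialCoeff.differentiable (by simp) x
  have h (i : Fin N) : fderiv ℝ (fun y => fderiv ℝ u y (EuclideanSpace.single i 1)) x
      (EuclideanSpace.single i 1) = radialCoeff u x +
        fderiv ℝ (radialCoeff u) x (EuclideanSpace.single i 1) * x i := by
    have h1 : (fun y => fderiv ℝ u y (EuclideanSpace.single i 1)) =
        fun y => radialCoeff u y * EuclideanSpace.proj (𝕜 := ℝ) i y := by
      ext y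
      rw [hu.fderiv_eq_radialCoeff hrad, EuclideanSpace.inner_single_right]
      simp
    rw [h1, (hd.hasFDerivAt.fun_mul (EuclideanSpace.proj (𝕜 := ℝ) i).hasFDerivAt).fderiv]
    simp [mul_comm]
  unfold lap
  simp_rw [h]
  rw [Finset.sum_add_distrib, EuclideanSpace.sum_apply_mul_eq]
  simp

/-- The divergence theorem for the vector field `φ(x) x`. -/
theorem integral_fderiv_apply_self_eq {N : ℕ} {φ : EuclideanSpace ℝ (Fin N) → ℝ}
    (hφ : ContDiff ℝ 1 φ) (hc : HasCompactSupport φ) :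
    Integrable (fun x => fderiv ℝ φ x x) ∧ ∫ x, fderiv ℝ φ x x = -(N * ∫ x, φ x) := by
  have hcont : Continuous (fderiv ℝ φ) := hφ.continuous_fderiv (by simp)
  have hint (i : Fin N) :
      Integrable (fun x => fderiv ℝ φ x (EuclideanSpace.single i 1) * x i) := by
    refine Continuous.integrable_of_hasCompactSupport (by fun_prop) ?_
    exact (hc.fderiv_apply ℝ _).mul_right
  have hφi : Integrable φ := hφ.continuous.integrable_of_hasCompactSupport hc
  have hpart (i : Fin N) :
      ∫ x, fderiv ℝ φ x (EuclideanSpace.single i 1) * x i = -∫ x, φ x := by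
    have hproj (x : EuclideanSpace ℝ (Fin N)) :
        fderiv ℝ (fun y : EuclideanSpace ℝ (Fin N) => y i) x (EuclideanSpace.single i 1) = 1 := by
      have := (EuclideanSpace.proj i : EuclideanSpace ℝ (Fin N) →L[ℝ] ℝ).hasFDerivAt (x := x)
      have h2 : HasFDerivAt (fun y : EuclideanSpace ℝ (Fin N) => y i)
        (EuclideanSpace.proj i : EuclideanSpace ℝ (Fin N) →L[ℝ] ℝ) x := this
      rw [h2.fderiv]
      simp
    have := integral_mul_fderiv_eq_neg_fderiv_mul_of_integrable (μ := volume) (𝕜 := ℝ)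
      (f := φ) (g := fun y : EuclideanSpace ℝ (Fin N) => y i) (v := EuclideanSpace.single i 1)
      (hint i) (by simpa [hproj] using hφi)
      (Continuous.integrable_of_hasCompactSupport (hφ.continuous.mul (by fun_prop)) hc.mul_right)
      (fun x _ => hφ.differentiable (by simp) x) (fun x _ => by fun_prop)
    simp only [hproj, mul_one] at this
    rw [this, neg_neg]
  have hsum : (fun x => fderiv ℝ φ x x) =
      fun x => ∑ i, fderiv ℝ φ x (EuclideanSpace.single i 1) * x i :=
    funext fun x => (EuclideanSpace.sum_apply_mul_eq _ x).symm
  rw [hsum]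
  refine ⟨integrable_finsetSum _ fun i _ => hint i, ?_⟩
  rw [integral_finsetSum _ fun i _ => hint i]
  simp [hpart]

theorem IsTestFn.support_lap_subset {N : ℕ} {u : EuclideanSpace ℝ (Fin N) → ℝ}
    (hu : IsTestFn u) (hrad : IsRadial u) : support (lap u) ⊆ tsupport u := by
  intro x hx
  by_contra h
  have h1 : radialCoeff u x = 0 := by
    by_contra h'
    exact h (support_radialCoeff_subset u h')
  have h2 : fderiv ℝ (radialCoeff u) x = 0 := by
    by_contra h'
    exact h (closure_minimal (support_radialCoeff_subset u) (isClosed_tsupport u)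
      (support_fderiv_subset ℝ h'))
  exact hx (by simp [hu.lap_eq hrad, h1, h2])

theorem IsTestFn.continuous_lap {N : ℕ} {u : EuclideanSpace ℝ (Fin N) → ℝ}
    (hu : IsTestFn u) (hrad : IsRadial u) : Continuous (lap u) := by
  have h1 := hu.contDiff_radialCoeff.continuous
  have h2 := hu.contDiff_radialCoeff.continuous_fderiv (by simp)
  rw [funext (hu.lap_eq hrad)]
  fun_prop

/-- Power weights are harmless for continuous functions supported in a compact set avoiding `0`. -/
theorem memLp_div_norm_rpow {N : ℕ} {f : EuclideanSpace ℝ (Fin N) → ℝ}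
    {K : Set (EuclideanSpace ℝ (Fin N))} (hK : IsCompact K) (h0 : 0 ∉ K) (hf : Continuous f)
    (hfK : support f ⊆ K) (s : ℝ) (p : ENNReal) : MemLp (fun x => f x / ‖x‖ ^ s) p := by
  have h : ContDiff ℝ 0 (fun x => f x * (‖x‖ ^ s)⁻¹) := by
    refine ContDiff.mul_of_support_subset hK.isClosed h0 (contDiff_zero.mpr hf) hfK ?_
    intro x hx
    exact (contDiffAt_norm_rpow_of_ne hx s).inv
      (Real.rpow_pos_of_pos (norm_pos_iff.mpr hx) s).ne'
  have hc : HasCompactSupport f :=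
    HasCompactSupport.of_support_subset_isCompact hK hfK
  simp_rw [div_eq_mul_inv]
  exact h.continuous.memLp_of_hasCompactSupport hc.mul_right

theorem abs_rpow_sub_two_mul_self {t : ℝ} (ht : 1 < t) (k : ℝ) :
    |(|k| ^ (t - 2) * k)| = |k| ^ (t - 1) := by
  rw [abs_mul, abs_of_nonneg (by positivity)]
  by_cases hk : k = 0
  · simp [hk, Real.zero_rpow (by linarith : t - 1 ≠ 0)]
  · rw [← Real.rpow_add_one (abs_ne_zero.mpr hk)]
    ring_nf

theorem abs_rpow_sub_two_mul_sq {t : ℝ} (ht : 1 < t) (k : ℝ) :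
    |k| ^ (t - 2) * k * k = |k| ^ t := by
  by_cases hk : k = 0
  · simp [hk, Real.zero_rpow (by linarith : t ≠ 0)]
  · rw [mul_assoc, ← sq, ← sq_abs, ← Real.rpow_natCast, ← Real.rpow_add (abs_pos.mpr hk)]
    norm_num

/-- Integrating the divergence of `|k|^t |x|^s x`, where `∇u = k x`, against the identity
`Δu = N k + x · ∇k`. -/
theorem IsTestFn.integral_lap_mul {N : ℕ} {u : EuclideanSpace ℝ (Fin N) → ℝ}
    (hu : IsTestFn u) (hrad : IsRadial u) {t : ℝ} (ht : 1 < t) (s : ℝ) :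
    t * ∫ x, |radialCoeff u x| ^ (t - 2) * radialCoeff u x * ‖x‖ ^ s * lap u x =
      -((N + s - t * N) * ∫ x, |radialCoeff u x| ^ t * ‖x‖ ^ s) := by
  set k := radialCoeff u with hk
  have hkd : ContDiff ℝ (⊤ : ℕ∞) k := hu.contDiff_radialCoeff
  have hkt : ContDiff ℝ 1 (fun x => |k x| ^ t) := by
    simpa [Function.comp_def] using (contDiff_norm_rpow (E := ℝ) ht).comp (hkd.of_le (by simp))
  have hsupp : support (fun x => |k x| ^ t) ⊆ tsupport u := by
    intro x hx
    refine support_radialCoeff_subset u fun h => hx ?_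
    simp [hk, h, Real.zero_rpow (by linarith : t ≠ 0)]
  have hφ : ContDiff ℝ 1 (fun x => |k x| ^ t * ‖x‖ ^ s) :=
    ContDiff.mul_of_support_subset (isClosed_tsupport u) hu.2.2 hkt hsupp
      fun x hx => contDiffAt_norm_rpow_of_ne hx s
  have hc : HasCompactSupport (fun x => |k x| ^ t * ‖x‖ ^ s) :=
    (HasCompactSupport.of_support_subset_isCompact hu.2.1 hsupp).mul_right
  obtain ⟨hint, hdiv⟩ := integral_fderiv_apply_self_eq hφ hc
  have hφi := hφ.continuous.integrable_of_hasCompactSupport (μ := volume) hc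
  have hpt (x : EuclideanSpace ℝ (Fin N)) : t * (|k x| ^ (t - 2) * k x * ‖x‖ ^ s * lap u x) =
      fderiv ℝ (fun x => |k x| ^ t * ‖x‖ ^ s) x x + (t * N - s) * (|k x| ^ t * ‖x‖ ^ s) := by
    by_cases hx : x = 0
    · subst hx
      simp [hk, radialCoeff_zero, Real.zero_rpow (by linarith : t ≠ 0)]
    have hnx : ‖x‖ ≠ 0 := norm_ne_zero_iff.mpr hx
    have h1 : HasFDerivAt (fun y => |k y| ^ t) ((t * |k x| ^ (t - 2) * k x) • fderiv ℝ k x) x :=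
      (hasDerivAt_abs_rpow (k x) ht).comp_hasFDerivAt x
        (hkd.differentiable (by simp) x).hasFDerivAt
    have h2 : fderiv ℝ (fun y : EuclideanSpace ℝ (Fin N) => ‖y‖ ^ s) x x = s * ‖x‖ ^ s := by
      have h3 := ((contDiffAt_norm ℝ hx (n := 1)).differentiableAt (by simp)).hasFDerivAt
      have h4 := (Real.hasDerivAt_rpow_const (p := s) (Or.inl hnx)).comp_hasFDerivAt x h3
      have h5 : fderiv ℝ (fun y : EuclideanSpace ℝ (Fin N) => ‖y‖) x x = ‖x‖ :=
        DifferentiableAt.fderiv_norm_self ((contDiffAt_norm ℝ hx (n := 1)).differentiableAt (by simp))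
      have h6 := h4.fderiv
      simp only [Function.comp_def] at h6
      rw [h6]
      simp only [smul_apply, smul_eq_mul, h5]
      rw [mul_assoc, ← Real.rpow_add_one hnx]
      ring_nf
    have h7 := (contDiffAt_norm_rpow_of_ne (n := 1) hx s).differentiableAt (by simp)
    rw [(h1.fun_mul h7.hasFDerivAt).fderiv, hu.lap_eq hrad]
    simp only [add_apply, smul_apply, smul_eq_mul, h2]
    rw [← hk, ← abs_rpow_sub_two_mul_sq ht (k x)]
    ring
  rw [← integral_const_mul]
  simp_rw [hpt]
  rw [integral_add hint (hφi.const_mul _), integral_const_mul, hdiv]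
  ring

/-- the second order Caffarelli–Kohn–Nirenberg inequality in radial space. -/
theorem second_order_CKN_radial (N : ℕ) (hN : 1 ≤ N) (p t α β γ : ℝ)
    (hp : 1 < p) (hpt : p ≤ t) (hγ : t * γ = α + (t - 1) * β + 1)
    (u : EuclideanSpace ℝ (Fin N) → ℝ) (hu : IsTestFn u) (hrad : IsRadial u) :
    (lapInt p (p * α) u) ^ (1 / p) *
        (gradInt (p * (t - 1) / (p - 1)) (p * (t - 1) / (p - 1) * β) u) ^ ((p - 1) / p) ≥
      |(N : ℝ) - t * ((N : ℝ) + γ - 1)| / t * gradInt t (t * γ) u := by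
  have ht : 1 < t := by linarith
  set k := radialCoeff u with hk
  set s := t - t * γ with hs
  have hgrad := hu.norm_gradient hrad
  have hpq : p.HolderConjugate (p / (p - 1)) := Real.HolderConjugate.conjExponent hp
  have hlap0 : lap u 0 = 0 := by
    by_contra h
    exact hu.2.2 (hu.support_lap_subset hrad h)
  have hφ (x : EuclideanSpace ℝ (Fin N)) :
      ‖gradient u x‖ ^ t / ‖x‖ ^ (t * γ) = |k x| ^ t * ‖x‖ ^ s := by
    by_cases hx : x = 0
    · subst hx
      simp [hgrad, hk, radialCoeff_zero, Real.zero_rpow (by linarith : t ≠ 0)]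
    · rw [hgrad, Real.mul_rpow (abs_nonneg _) (norm_nonneg _), hs,
        Real.rpow_sub (norm_pos_iff.mpr hx), mul_div_assoc]
  have hψ (x : EuclideanSpace ℝ (Fin N)) :
      |(|k x| ^ (t - 2) * k x * ‖x‖ ^ s * lap u x)| =
        |lap u x| / ‖x‖ ^ α * (‖gradient u x‖ ^ (t - 1) / ‖x‖ ^ ((t - 1) * β)) := by
    by_cases hx : x = 0
    · subst hx
      simp [hlap0]
    · have hx' : 0 < ‖x‖ := norm_pos_iff.mpr hx
      have hs' : s = t - 1 - α - (t - 1) * β := by rw [hs, hγ]; ring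
      rw [abs_mul, abs_mul, abs_rpow_sub_two_mul_self ht, abs_of_nonneg (by positivity : 0 ≤ ‖x‖ ^ s),
        hgrad, Real.mul_rpow (abs_nonneg _) (norm_nonneg _), hs', Real.rpow_sub hx',
        Real.rpow_sub hx']
      ring
  have hgc : Continuous fun x => ‖gradient u x‖ ^ (t - 1) := by
    simp_rw [hgrad]
    exact ((hu.contDiff_radialCoeff.continuous.abs).mul continuous_norm).rpow_const
      fun _ => Or.inr (by linarith)
  have hgs : support (fun x => ‖gradient u x‖ ^ (t - 1)) ⊆ tsupport u := by
    intro x hx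
    refine support_radialCoeff_subset u fun h => hx ?_
    simp [hgrad, h, Real.zero_rpow (by linarith : t - 1 ≠ 0)]
  have hls : support (fun x => |lap u x|) ⊆ tsupport u := by
    intro x hx
    exact hu.support_lap_subset hrad fun h => hx (by simp [h])
  have holder := integral_mul_le_Lp_mul_Lq_of_nonneg (μ := volume) hpq
    (f := fun x => |lap u x| / ‖x‖ ^ α)
    (g := fun x => ‖gradient u x‖ ^ (t - 1) / ‖x‖ ^ ((t - 1) * β))
    (Filter.Eventually.of_forall fun x => by positivity)
    (Filter.Eventually.of_forall fun x => by positivity)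
    (memLp_div_norm_rpow hu.2.1 hu.2.2 (hu.continuous_lap hrad).abs hls _ _)
    (memLp_div_norm_rpow hu.2.1 hu.2.2 hgc hgs _ _)
  have hL : ∫ x, (|lap u x| / ‖x‖ ^ α) ^ p = lapInt p (p * α) u := by
    refine integral_congr_ae (Filter.Eventually.of_forall fun x => ?_)
    simp only
    rw [Real.div_rpow (by positivity) (by positivity), ← Real.rpow_mul (norm_nonneg _),
      mul_comm α p]
  have hG : ∫ x, (‖gradient u x‖ ^ (t - 1) / ‖x‖ ^ ((t - 1) * β)) ^ (p / (p - 1)) =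
      gradInt (p * (t - 1) / (p - 1)) (p * (t - 1) / (p - 1) * β) u := by
    refine integral_congr_ae (Filter.Eventually.of_forall fun x => ?_)
    simp only
    rw [Real.div_rpow (by positivity) (by positivity), ← Real.rpow_mul (norm_nonneg _),
      ← Real.rpow_mul (norm_nonneg _)]
    ring_nf
  rw [hL, hG, one_div_div] at holder
  refine le_trans ?_ holder
  have key := hu.integral_lap_mul hrad ht s
  have hI : gradInt t (t * γ) u = ∫ x, |k x| ^ t * ‖x‖ ^ s :=
    integral_congr_ae (Filter.Eventually.of_forall hφ)
  have hI0 : 0 ≤ gradInt t (t * γ) u := integral_nonneg fun x => by positivity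
  rw [← hk, ← hI] at key
  have habs := congrArg abs key
  rw [abs_mul, abs_neg, abs_mul, abs_of_pos (by linarith : 0 < t), abs_of_nonneg hI0,
    show (N : ℝ) + s - t * N = N - t * (N + γ - 1) by rw [hs]; ring] at habs
  rw [div_mul_eq_mul_div, ← habs, mul_div_cancel_left₀ _ (by linarith : t ≠ 0)]
  simp_rw [← hψ]
  exact abs_integral_le_integral_abs
end
end

section
/- Let N ≥ 1 be an integer and α ∈ ℝ satisfy one of: (Case 1) α + 1 > 0, N − 2α > 0 and N − (√5 − 1)α − (√5 + 1) > 0; (Case 2) N + 2α < 0, N + (√5 + 1)α + (√5 − 1) > 0 and N − 2√2·α − 2√2 > 0; (Case 3) α + 1 < 0 and N + 4α + 2 > 0. Then for every u ∈ C_c^∞(ℝ^N∖{0}): (∫ |Δu|²/|x|^{2α} dx)^{1/2} (∫ |x|^{2α+2} |∇u|² dx)^{1/2} ≥ (|N + 4α + 2|/2) ∫ |∇u|² dx. -/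
open MeasureTheory Real RealInnerProductSpace

noncomputable section

/-- The left-hand side of the weighted second order Heisenberg Uncertainty Principle:
`(∫ |Δu|²/|x|^{2α})^{1/2} (∫ |x|^{2α+2} |∇u|²)^{1/2}`. -/
def hupLHS (N : ℕ) (α : ℝ) (u : EuclideanSpace ℝ (Fin N) → ℝ) : ℝ :=
  (∫ x : EuclideanSpace ℝ (Fin N), |lap u x| ^ 2 / ‖x‖ ^ (2 * α)) ^ ((1 : ℝ) / 2) *
    (∫ x : EuclideanSpace ℝ (Fin N), ‖x‖ ^ (2 * α + 2) * ‖gradient u x‖ ^ 2) ^ ((1 : ℝ) / 2)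

/-- The Dirichlet energy `∫ |∇u|² dx`. -/
def dirichlet (N : ℕ) (u : EuclideanSpace ℝ (Fin N) → ℝ) : ℝ :=
  ∫ x : EuclideanSpace ℝ (Fin N), ‖gradient u x‖ ^ 2

section PartialDerivatives

variable {N : ℕ}

/-- The `i`-th partial derivative of `f`. -/
def partialDeriv (i : Fin N) (f : EuclideanSpace ℝ (Fin N) → ℝ)
    (x : EuclideanSpace ℝ (Fin N)) : ℝ :=
  fderiv ℝ f x (EuclideanSpace.single i 1)

/-- `f` is differentiable at `x`, with `i`-th partial derivative `c`. -/
def HasPartialDerivAt (i : Fin N) (f : EuclideanSpace ℝ (Fin N) → ℝ) (c : ℝ)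
    (x : EuclideanSpace ℝ (Fin N)) : Prop :=
  DifferentiableAt ℝ f x ∧ partialDeriv i f x = c

variable {i : Fin N} {f g : EuclideanSpace ℝ (Fin N) → ℝ} {c d : ℝ}
  {x : EuclideanSpace ℝ (Fin N)}

lemma HasPartialDerivAt.of_hasFDerivAt {f' : EuclideanSpace ℝ (Fin N) →L[ℝ] ℝ}
    (h : HasFDerivAt f f' x) : HasPartialDerivAt i f (f' (EuclideanSpace.single i 1)) x :=
  ⟨h.differentiableAt, by rw [partialDeriv, h.fderiv]⟩

lemma HasPartialDerivAt.add (hf : HasPartialDerivAt i f c x) (hg : HasPartialDerivAt i g d x) :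
    HasPartialDerivAt i (fun y => f y + g y) (c + d) x := by
  convert! HasPartialDerivAt.of_hasFDerivAt (hf.1.hasFDerivAt.add hg.1.hasFDerivAt) using 1
  rw [← hf.2, ← hg.2]
  rfl

lemma HasPartialDerivAt.sub (hf : HasPartialDerivAt i f c x) (hg : HasPartialDerivAt i g d x) :
    HasPartialDerivAt i (fun y => f y - g y) (c - d) x := by
  convert! HasPartialDerivAt.of_hasFDerivAt (hf.1.hasFDerivAt.sub hg.1.hasFDerivAt) using 1
  rw [← hf.2, ← hg.2]
  rfl

lemma HasPartialDerivAt.mul (hf : HasPartialDerivAt i f c x) (hg : HasPartialDerivAt i g d x) :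
    HasPartialDerivAt i (fun y => f y * g y) (c * g x + f x * d) x := by
  convert! HasPartialDerivAt.of_hasFDerivAt (hf.1.hasFDerivAt.mul hg.1.hasFDerivAt) using 1
  rw [← hf.2, ← hg.2]
  simp [partialDeriv]
  ring

lemma HasPartialDerivAt.const_mul (a : ℝ) (hf : HasPartialDerivAt i f c x) :
    HasPartialDerivAt i (fun y => a * f y) (a * c) x := by
  convert! HasPartialDerivAt.of_hasFDerivAt (hf.1.hasFDerivAt.const_mul a) using 1
  rw [← hf.2]
  rfl

lemma HasPartialDerivAt.sum {F : Fin N → EuclideanSpace ℝ (Fin N) → ℝ} {C : Fin N → ℝ}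
    (h : ∀ j, HasPartialDerivAt i (F j) (C j) x) :
    HasPartialDerivAt i (fun y => ∑ j, F j y) (∑ j, C j) x := by
  convert! HasPartialDerivAt.of_hasFDerivAt
    (HasFDerivAt.fun_sum (u := Finset.univ) fun j _ => (h j).1.hasFDerivAt) using 1
  rw [_root_.sum_apply]
  exact Finset.sum_congr rfl fun j _ => (h j).2.symm

lemma hasPartialDerivAt_coord (i j : Fin N) (x : EuclideanSpace ℝ (Fin N)) :
    HasPartialDerivAt i (fun y : EuclideanSpace ℝ (Fin N) => y j) (if j = i then 1 else 0) x := by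
  convert! HasPartialDerivAt.of_hasFDerivAt
    (EuclideanSpace.proj j : EuclideanSpace ℝ (Fin N) →L[ℝ] ℝ).hasFDerivAt using 1
  simp

lemma hasPartialDerivAt_norm_rpow (i : Fin N) (p : ℝ) (hx : x ≠ 0) :
    HasPartialDerivAt i (fun y => ‖y‖ ^ p) (p * ‖x‖ ^ (p - 2) * x i) x := by
  have hpos : 0 < ‖x‖ := norm_pos_iff.2 hx
  have h := ((hasStrictFDerivAt_norm_sq x).hasFDerivAt).rpow_const (p := p / 2)
    (Or.inl (by positivity))
  have key : ∀ (y : EuclideanSpace ℝ (Fin N)) (q : ℝ), (‖y‖ ^ 2) ^ (q / 2) = ‖y‖ ^ q := by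
    intro y q
    rw [← Real.rpow_natCast, ← Real.rpow_mul (norm_nonneg _)]
    congr 1
    push_cast
    ring
  have h2 : p / 2 - 1 = (p - 2) / 2 := by ring
  simp only [key, h2] at h
  convert! HasPartialDerivAt.of_hasFDerivAt (i := i) h using 1
  simp [EuclideanSpace.inner_single_right]
  ring

lemma ContDiff.partialDeriv (hf : ContDiff ℝ (⊤ : ℕ∞) f) (i : Fin N) :
    ContDiff ℝ (⊤ : ℕ∞) (partialDeriv i f) :=
  (hf.fderiv_right (m := (⊤ : ℕ∞)) (by simp)).clm_apply contDiff_const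

lemma ContDiff.hasPartialDerivAt (hf : ContDiff ℝ (⊤ : ℕ∞) f) (i : Fin N)
    (x : EuclideanSpace ℝ (Fin N)) : HasPartialDerivAt i f (_root_.partialDeriv i f x) x :=
  ⟨(hf.differentiable (by simp)) x, rfl⟩

lemma partialDeriv_comm (hf : ContDiff ℝ (⊤ : ℕ∞) f) (i j : Fin N) :
    partialDeriv i (partialDeriv j f) = partialDeriv j (partialDeriv i f) := by
  have hd : Differentiable ℝ (fderiv ℝ f) :=
    (hf.fderiv_right (m := (⊤ : ℕ∞)) (by simp)).differentiable (by simp)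
  have hs : ∀ (k l : Fin N) (x : EuclideanSpace ℝ (Fin N)), partialDeriv k (partialDeriv l f) x =
      fderiv ℝ (fderiv ℝ f) x (EuclideanSpace.single k 1) (EuclideanSpace.single l 1) := by
    intro k l x
    have := fderiv_clm_apply (hd x) (differentiableAt_const (EuclideanSpace.single l (1 : ℝ)))
    change fderiv ℝ (fun y => fderiv ℝ f y (EuclideanSpace.single l 1)) x _ = _
    rw [this]
    simp
  funext x
  rw [hs, hs]
  exact (hf.contDiffAt (x := x)).isSymmSndFDerivAt
    (by simpa using WithTop.coe_le_coe.2 (le_top : (2 : ℕ∞) ≤ ⊤)) _ _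

lemma partialDeriv_eq_zero (h : x ∉ tsupport f) : partialDeriv i f x = 0 := by
  rw [partialDeriv, fderiv_of_notMem_tsupport ℝ h]
  rfl

lemma tsupport_partialDeriv_subset (i : Fin N) (f : EuclideanSpace ℝ (Fin N) → ℝ) :
    tsupport (partialDeriv i f) ⊆ tsupport f :=
  tsupport_fderiv_apply_subset ℝ _

lemma integrable_partialDeriv (hf : ContDiff ℝ (⊤ : ℕ∞) f) (hc : HasCompactSupport f) :
    Integrable (partialDeriv i f) :=
  (hf.partialDeriv i).continuous.integrable_of_hasCompactSupport
    (hc.mono' ((subset_tsupport _).trans (tsupport_partialDeriv_subset i f)))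

lemma integral_partialDeriv (hf : ContDiff ℝ (⊤ : ℕ∞) f) (hc : HasCompactSupport f) :
    ∫ x, partialDeriv i f x = 0 := by
  have h := integral_mul_fderiv_eq_neg_fderiv_mul_of_integrable
    (μ := (volume : Measure (EuclideanSpace ℝ (Fin N))))
    (f := fun _ => (1 : ℝ)) (g := f) (v := EuclideanSpace.single i 1)
    (by simp) (by simp only [one_mul]; exact integrable_partialDeriv hf hc)
    (by simpa using hf.continuous.integrable_of_hasCompactSupport hc)
    (fun x _ => differentiableAt_const 1) (fun x _ => hf.differentiable (by simp) x)
  simpa [partialDeriv] using h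

lemma integrable_divergence {F : Fin N → EuclideanSpace ℝ (Fin N) → ℝ}
    (hF : ∀ i, ContDiff ℝ (⊤ : ℕ∞) (F i)) (hc : ∀ i, HasCompactSupport (F i)) :
    Integrable (fun x => ∑ i, partialDeriv i (F i) x) :=
  integrable_finsetSum _ fun i _ => integrable_partialDeriv (hF i) (hc i)

/-- The divergence of a smooth compactly supported vector field integrates to zero. -/
lemma integral_divergence {F : Fin N → EuclideanSpace ℝ (Fin N) → ℝ}
    (hF : ∀ i, ContDiff ℝ (⊤ : ℕ∞) (F i)) (hc : ∀ i, HasCompactSupport (F i)) :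
    ∫ x, ∑ i, partialDeriv i (F i) x = 0 := by
  rw [integral_finsetSum _ fun i _ => integrable_partialDeriv (hF i) (hc i)]
  exact Finset.sum_eq_zero fun i _ => integral_partialDeriv (hF i) (hc i)

end PartialDerivatives

section RadialFields

variable {N : ℕ}

/-- `x · ∇u`. -/
def eulerDeriv (u : EuclideanSpace ℝ (Fin N) → ℝ) (x : EuclideanSpace ℝ (Fin N)) : ℝ :=
  ∑ j, x j * partialDeriv j u x

/-- The `i`-th component of `D²u(x) x`. -/
def hessRadial (u : EuclideanSpace ℝ (Fin N) → ℝ) (i : Fin N)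
    (x : EuclideanSpace ℝ (Fin N)) : ℝ :=
  ∑ j, x j * partialDeriv i (partialDeriv j u) x

/-- `|∇u|²`. -/
def gradSq (u : EuclideanSpace ℝ (Fin N) → ℝ) (x : EuclideanSpace ℝ (Fin N)) : ℝ :=
  ∑ j, partialDeriv j u x * partialDeriv j u x

/-- A vector field whose divergence is `|x|^(-2α-2) |A|² - |x|^(-2α) |Δu|²`, where
`A = 2 D²u x - Δu x + (N - 2 - 2α) ∇u`. -/
def weightedField (α : ℝ) (u : EuclideanSpace ℝ (Fin N) → ℝ) (i : Fin N)
    (x : EuclideanSpace ℝ (Fin N)) : ℝ :=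
  ‖x‖ ^ (-2 * α - 2) * (4 * (eulerDeriv u x * (hessRadial u i x - lap u x * x i)) +
      2 * (N - 2 - 2 * α) * (eulerDeriv u x * partialDeriv i u x) +
      (N - 4 - 2 * α) * (gradSq u x * x i)) +
    4 * (α + 1) * (‖x‖ ^ (-2 * α - 4) * (eulerDeriv u x * eulerDeriv u x * x i))

/-- The Rellich-Pohozaev vector field `3 |∇u|² x - 2 (x · ∇u) ∇u`. -/
def pohozaevField (u : EuclideanSpace ℝ (Fin N) → ℝ) (i : Fin N)
    (x : EuclideanSpace ℝ (Fin N)) : ℝ :=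
  3 * (gradSq u x * x i) - 2 * (eulerDeriv u x * partialDeriv i u x)

variable {u : EuclideanSpace ℝ (Fin N) → ℝ} {x : EuclideanSpace ℝ (Fin N)}

lemma lap_eq_sum (u : EuclideanSpace ℝ (Fin N) → ℝ) :
    lap u = fun x => ∑ i, partialDeriv i (partialDeriv i u) x := rfl

lemma contDiff_coord (i : Fin N) :
    ContDiff ℝ (⊤ : ℕ∞) (fun x : EuclideanSpace ℝ (Fin N) => x i) :=
  (EuclideanSpace.proj i : EuclideanSpace ℝ (Fin N) →L[ℝ] ℝ).contDiff

lemma ContDiff.lap (hu : ContDiff ℝ (⊤ : ℕ∞) u) : ContDiff ℝ (⊤ : ℕ∞) (lap u) :=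
  ContDiff.sum fun i _ => (hu.partialDeriv i).partialDeriv i

lemma ContDiff.eulerDeriv (hu : ContDiff ℝ (⊤ : ℕ∞) u) : ContDiff ℝ (⊤ : ℕ∞) (eulerDeriv u) :=
  ContDiff.sum fun j _ => (contDiff_coord j).mul (hu.partialDeriv j)

lemma ContDiff.hessRadial (hu : ContDiff ℝ (⊤ : ℕ∞) u) (i : Fin N) :
    ContDiff ℝ (⊤ : ℕ∞) (hessRadial u i) :=
  ContDiff.sum fun j _ => (contDiff_coord j).mul ((hu.partialDeriv j).partialDeriv i)

lemma ContDiff.gradSq (hu : ContDiff ℝ (⊤ : ℕ∞) u) : ContDiff ℝ (⊤ : ℕ∞) (gradSq u) :=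
  ContDiff.sum fun j _ => (hu.partialDeriv j).mul (hu.partialDeriv j)

lemma hasPartialDerivAt_eulerDeriv (hu : ContDiff ℝ (⊤ : ℕ∞) u) (i : Fin N) :
    HasPartialDerivAt i (eulerDeriv u) (partialDeriv i u x + hessRadial u i x) x := by
  have h := HasPartialDerivAt.sum fun j =>
    (hasPartialDerivAt_coord i j x).mul ((hu.partialDeriv j).hasPartialDerivAt i x)
  convert! h using 1
  simp [Finset.sum_add_distrib, hessRadial]

lemma hasPartialDerivAt_hessRadial (hu : ContDiff ℝ (⊤ : ℕ∞) u) (i : Fin N) :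
    HasPartialDerivAt i (hessRadial u i) (partialDeriv i (partialDeriv i u) x +
      ∑ j, x j * partialDeriv j (partialDeriv i (partialDeriv i u)) x) x := by
  have h := HasPartialDerivAt.sum fun j => (hasPartialDerivAt_coord i j x).mul
    (((hu.partialDeriv j).partialDeriv i).hasPartialDerivAt i x)
  convert! h using 1
  simp only [partialDeriv_comm (hu.partialDeriv i) _ i, partialDeriv_comm hu _ i]
  simp [Finset.sum_add_distrib]

lemma hasPartialDerivAt_gradSq (hu : ContDiff ℝ (⊤ : ℕ∞) u) (i : Fin N) :
    HasPartialDerivAt i (gradSq u)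
      (2 * ∑ j, partialDeriv j u x * partialDeriv i (partialDeriv j u) x) x := by
  have h := HasPartialDerivAt.sum fun j => ((hu.partialDeriv j).hasPartialDerivAt i x).mul
    ((hu.partialDeriv j).hasPartialDerivAt i x)
  convert! h using 1
  rw [Finset.mul_sum]
  exact Finset.sum_congr rfl fun j _ => by ring

lemma sum_mul_partialDeriv_gradSq (hu : ContDiff ℝ (⊤ : ℕ∞) u) :
    ∑ i, x i * ∑ j, partialDeriv j u x * partialDeriv i (partialDeriv j u) x =
      ∑ i, partialDeriv i u x * hessRadial u i x := by
  simp only [hessRadial, Finset.mul_sum]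
  rw [Finset.sum_comm]
  refine Finset.sum_congr rfl fun i _ => Finset.sum_congr rfl fun j _ => ?_
  rw [partialDeriv_comm hu i j]
  ring

lemma sum_partialDeriv_hessRadial (hu : ContDiff ℝ (⊤ : ℕ∞) u) :
    ∑ i, partialDeriv i (hessRadial u i) x = lap u x + ∑ i, x i * partialDeriv i (lap u) x := by
  have hL : ∀ j, partialDeriv j (lap u) x =
      ∑ i, partialDeriv j (partialDeriv i (partialDeriv i u)) x := fun j =>
    (HasPartialDerivAt.sum fun i =>
      ((hu.partialDeriv i).partialDeriv i).hasPartialDerivAt j x).2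
  simp only [(hasPartialDerivAt_hessRadial hu _).2, Finset.sum_add_distrib, hL, Finset.mul_sum]
  rw [Finset.sum_comm, lap_eq_sum]

lemma divergence_pohozaevField (hu : ContDiff ℝ (⊤ : ℕ∞) u) (x : EuclideanSpace ℝ (Fin N)) :
    ∑ i, partialDeriv i (pohozaevField u i) x =
      4 * ∑ i, partialDeriv i u x * hessRadial u i x - 2 * lap u x * eulerDeriv u x +
        (3 * N - 2) * gradSq u x := by
  have hD : ∀ i, partialDeriv i (pohozaevField u i) x =
      6 * (x i * ∑ j, partialDeriv j u x * partialDeriv i (partialDeriv j u) x) +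
      3 * gradSq u x + -2 * (partialDeriv i u x * partialDeriv i u x) +
      -2 * (partialDeriv i u x * hessRadial u i x) +
      -2 * eulerDeriv u x * partialDeriv i (partialDeriv i u) x := by
    intro i
    have h := (((hasPartialDerivAt_gradSq (x := x) hu i).mul
        (hasPartialDerivAt_coord i i x)).const_mul 3).sub
      (((hasPartialDerivAt_eulerDeriv (x := x) hu i).mul
        ((hu.partialDeriv i).hasPartialDerivAt i x)).const_mul 2)
    refine h.2.trans ?_
    simp only [if_true]
    ring
  simp only [hD, Finset.sum_add_distrib, ← Finset.mul_sum]
  rw [sum_mul_partialDeriv_gradSq hu]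
  simp only [lap_eq_sum, gradSq, Finset.sum_const, Finset.card_univ, Fintype.card_fin,
    nsmul_eq_mul]
  ring

lemma norm_rpow_add_two (hx : x ≠ 0) (p : ℝ) : ‖x‖ ^ (p + 2) = ‖x‖ ^ p * ‖x‖ ^ 2 := by
  rw [Real.rpow_add (norm_pos_iff.2 hx)]
  norm_cast

lemma norm_sq_eq_sum_mul (x : EuclideanSpace ℝ (Fin N)) : ‖x‖ ^ 2 = ∑ i, x i * x i := by
  simp only [EuclideanSpace.real_norm_sq_eq, ← sq]

lemma divergence_weightedField (α : ℝ) (hu : ContDiff ℝ (⊤ : ℕ∞) u) (hx : x ≠ 0) :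
    ∑ i, partialDeriv i (weightedField α u i) x = ‖x‖ ^ (-2 * α - 2) *
      (4 * ∑ i, hessRadial u i x * hessRadial u i x -
        4 * lap u x * ∑ i, x i * hessRadial u i x +
        4 * (N - 2 - 2 * α) * ∑ i, partialDeriv i u x * hessRadial u i x -
        2 * (N - 2 - 2 * α) * lap u x * eulerDeriv u x +
        (N - 2 - 2 * α) ^ 2 * gradSq u x) := by
  set P := ‖x‖ ^ (-2 * α - 6) with hP
  set s := ‖x‖ ^ 2 with hs
  have h4 : ‖x‖ ^ (-2 * α - 4) = P * s := by
    rw [hP, hs, ← norm_rpow_add_two hx]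
    congr 1
    ring
  have h2 : ‖x‖ ^ (-2 * α - 2) = P * s ^ 2 := by
    rw [sq, ← mul_assoc, ← h4, hs, ← norm_rpow_add_two hx]
    congr 1
    ring
  set Q := eulerDeriv u x with hQ
  set S := gradSq u x with hS
  set L := lap u x with hL
  have hD : ∀ i, partialDeriv i (weightedField α u i) x =
      ((-2 * α - 2) * P * s * (-4 * Q * L + (N - 4 - 2 * α) * S) +
        4 * (α + 1) * (-2 * α - 4) * P * Q ^ 2) * (x i * x i) +
      ((-2 * α - 2) * P * s * 2 * (N - 2 - 2 * α) * Q - 4 * P * s ^ 2 * L +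
        8 * (α + 1) * P * s * Q) * (x i * partialDeriv i u x) +
      (-4 * P * s ^ 2 * L) * (x i * hessRadial u i x) +
      (2 * (N - 4 - 2 * α) * P * s ^ 2) *
        (x i * ∑ j, partialDeriv j u x * partialDeriv i (partialDeriv j u) x) +
      ((4 + 2 * (N - 2 - 2 * α)) * P * s ^ 2) * (partialDeriv i u x * hessRadial u i x) +
      (4 * P * s ^ 2) * (hessRadial u i x * hessRadial u i x) +
      (2 * (N - 2 - 2 * α) * P * s ^ 2) * (partialDeriv i u x * partialDeriv i u x) +
      (4 * Q * P * s ^ 2) * partialDeriv i (hessRadial u i) x +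
      (-4 * Q * P * s ^ 2) * (x i * partialDeriv i (lap u) x) +
      (2 * (N - 2 - 2 * α) * Q * P * s ^ 2) * partialDeriv i (partialDeriv i u) x +
      (P * s ^ 2 * (-4 * Q * L + (N - 4 - 2 * α) * S) + 4 * (α + 1) * P * s * Q ^ 2) := by
    intro i
    have hX := hasPartialDerivAt_coord i i x
    have hE := hasPartialDerivAt_eulerDeriv (x := x) hu i
    have h := ((hasPartialDerivAt_norm_rpow i (-2 * α - 2) hx).mul
      ((((hE.mul (((hu.hessRadial i).hasPartialDerivAt i x).sub
            ((hu.lap.hasPartialDerivAt i x).mul hX))).const_mul 4).add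
          ((hE.mul ((hu.partialDeriv i).hasPartialDerivAt i x)).const_mul
            (2 * (N - 2 - 2 * α)))).add
          (((hasPartialDerivAt_gradSq (x := x) hu i).mul hX).const_mul (N - 4 - 2 * α)))).add
      (((hasPartialDerivAt_norm_rpow i (-2 * α - 4) hx).mul
        ((hE.mul hE).mul hX)).const_mul (4 * (α + 1)))
    refine h.2.trans ?_
    have e4 : -2 * α - 2 - 2 = -2 * α - 4 := by ring
    have e6 : -2 * α - 4 - 2 = -2 * α - 6 := by ring
    simp only [if_true, e4, e6, h4, h2, ← hP, ← hQ, ← hS, ← hL]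
    ring
  simp only [hD, Finset.sum_add_distrib, ← Finset.mul_sum]
  rw [sum_mul_partialDeriv_gradSq hu, sum_partialDeriv_hessRadial hu, ← norm_sq_eq_sum_mul,
    ← hs, h2]
  have hQ' : ∑ i, x i * partialDeriv i u x = Q := rfl
  have hS' : ∑ i, partialDeriv i u x * partialDeriv i u x = S := rfl
  have hL' : ∑ i, partialDeriv i (partialDeriv i u) x = L := rfl
  simp only [hQ', hS', hL', ← hL, Finset.sum_const, Finset.card_univ, Fintype.card_fin,
    nsmul_eq_mul]
  ring

end RadialFields

section TestFunctions

variable {N : ℕ} {u : EuclideanSpace ℝ (Fin N) → ℝ} {x : EuclideanSpace ℝ (Fin N)}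

lemma partialDeriv_partialDeriv_eq_zero (h : x ∉ tsupport u) (i j : Fin N) :
    partialDeriv i (partialDeriv j u) x = 0 :=
  partialDeriv_eq_zero fun h' => h (tsupport_partialDeriv_subset j u h')

lemma lap_eq_zero (h : x ∉ tsupport u) : lap u x = 0 :=
  Finset.sum_eq_zero fun i _ => partialDeriv_partialDeriv_eq_zero h i i

lemma eulerDeriv_eq_zero (h : x ∉ tsupport u) : eulerDeriv u x = 0 :=
  Finset.sum_eq_zero fun i _ => by rw [partialDeriv_eq_zero h, mul_zero]

lemma gradSq_eq_zero (h : x ∉ tsupport u) : gradSq u x = 0 :=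
  Finset.sum_eq_zero fun i _ => by rw [partialDeriv_eq_zero h, mul_zero]

lemma weightedField_eq_zero (α : ℝ) (i : Fin N) (h : x ∉ tsupport u) :
    weightedField α u i x = 0 := by
  simp [weightedField, eulerDeriv_eq_zero h, gradSq_eq_zero h]

lemma pohozaevField_eq_zero (i : Fin N) (h : x ∉ tsupport u) : pohozaevField u i x = 0 := by
  simp [pohozaevField, eulerDeriv_eq_zero h, gradSq_eq_zero h]

lemma tsupport_subset_of_eq_zero {f : EuclideanSpace ℝ (Fin N) → ℝ}
    (h : ∀ x ∉ tsupport u, f x = 0) : tsupport f ⊆ tsupport u :=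
  closure_minimal (fun x hx => by_contra fun hn => hx (h x hn)) (isClosed_tsupport u)

lemma IsTestFn.hasCompactSupport (hu : IsTestFn u) {f : EuclideanSpace ℝ (Fin N) → ℝ}
    (h : ∀ x ∉ tsupport u, f x = 0) : HasCompactSupport f :=
  hu.2.1.mono' ((subset_tsupport f).trans (tsupport_subset_of_eq_zero h))

lemma IsTestFn.contDiff (hu : IsTestFn u) {f : EuclideanSpace ℝ (Fin N) → ℝ}
    (h : ∀ x ∉ tsupport u, f x = 0) (hf : ∀ x ≠ 0, ContDiffAt ℝ (⊤ : ℕ∞) f x) :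
    ContDiff ℝ (⊤ : ℕ∞) f := by
  refine contDiff_iff_contDiffAt.2 fun x => ?_
  by_cases hx : x ∈ tsupport f
  · exact hf x fun h0 => hu.2.2 (h0 ▸ tsupport_subset_of_eq_zero h hx)
  · exact contDiffAt_const.congr_of_eventuallyEq (notMem_tsupport_iff_eventuallyEq.1 hx)

lemma IsTestFn.integrable (hu : IsTestFn u) {f : EuclideanSpace ℝ (Fin N) → ℝ}
    (h : ∀ x ∉ tsupport u, f x = 0) (hf : ∀ x ≠ 0, ContDiffAt ℝ (⊤ : ℕ∞) f x) :
    Integrable f :=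
  (hu.contDiff h hf).continuous.integrable_of_hasCompactSupport (hu.hasCompactSupport h)

lemma contDiffAt_norm_rpow (p : ℝ) (hx : x ≠ 0) :
    ContDiffAt ℝ (⊤ : ℕ∞) (fun y : EuclideanSpace ℝ (Fin N) => ‖y‖ ^ p) x :=
  (contDiffAt_norm ℝ hx).rpow_const_of_ne (norm_ne_zero_iff.2 hx)

lemma contDiffAt_weightedField (α : ℝ) (hu : ContDiff ℝ (⊤ : ℕ∞) u) (i : Fin N) (hx : x ≠ 0) :
    ContDiffAt ℝ (⊤ : ℕ∞) (weightedField α u i) x := by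
  have hX := contDiff_coord i
  exact ((contDiffAt_norm_rpow _ hx).mul
    (((contDiff_const.mul (hu.eulerDeriv.mul ((hu.hessRadial i).sub (hu.lap.mul hX)))).add
      (contDiff_const.mul (hu.eulerDeriv.mul (hu.partialDeriv i)))).add
      (contDiff_const.mul (hu.gradSq.mul hX))).contDiffAt).add
    (contDiffAt_const.mul ((contDiffAt_norm_rpow _ hx).mul
      ((hu.eulerDeriv.mul hu.eulerDeriv).mul hX).contDiffAt))

lemma contDiff_pohozaevField (hu : ContDiff ℝ (⊤ : ℕ∞) u) (i : Fin N) :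
    ContDiff ℝ (⊤ : ℕ∞) (pohozaevField u i) :=
  (contDiff_const.mul (hu.gradSq.mul (contDiff_coord i))).sub
    (contDiff_const.mul (hu.eulerDeriv.mul (hu.partialDeriv i)))

lemma norm_gradient_sq (u : EuclideanSpace ℝ (Fin N) → ℝ) (x : EuclideanSpace ℝ (Fin N)) :
    ‖gradient u x‖ ^ 2 = gradSq u x := by
  have h : ∀ i, gradient u x i = partialDeriv i u x := by
    intro i
    have := InnerProductSpace.toDual_symm_apply (𝕜 := ℝ) (x := EuclideanSpace.single i (1 : ℝ))
      (y := fderiv ℝ u x)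
    rw [EuclideanSpace.inner_single_right] at this
    simpa [gradient, partialDeriv] using this
  simp only [norm_sq_eq_sum_mul, h, gradSq]

/-- Up to divergences, the quadratic polynomial in `t` attached to the uncertainty principle is
`|x|^(-2α-2) |2 D²u x - Δu x + (N - 2 - 2α + t |x|^(2α+2)) ∇u|²`. -/
lemma nonneg_quadratic_add_divergence (α t : ℝ) (hu : IsTestFn u)
    (x : EuclideanSpace ℝ (Fin N)) :
    0 ≤ t ^ 2 * (‖x‖ ^ (2 * α + 2) * gradSq u x) + t * (-((N : ℝ) + 4 * α + 2) * gradSq u x) +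
      lap u x ^ 2 / ‖x‖ ^ (2 * α) + ∑ i, partialDeriv i (weightedField α u i) x +
      t * ∑ i, partialDeriv i (pohozaevField u i) x := by
  by_cases hx : x = 0
  · have h0 : x ∉ tsupport u := hx ▸ hu.2.2
    have h1 : ∀ i, partialDeriv i (weightedField α u i) x = 0 := fun i =>
      partialDeriv_eq_zero fun h =>
        h0 (tsupport_subset_of_eq_zero (fun y => weightedField_eq_zero α i) h)
    have h2 : ∀ i, partialDeriv i (pohozaevField u i) x = 0 := fun i =>
      partialDeriv_eq_zero fun h =>
        h0 (tsupport_subset_of_eq_zero (fun y => pohozaevField_eq_zero i) h)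
    simp [gradSq_eq_zero h0, lap_eq_zero h0, h1, h2]
  have hpos : 0 < ‖x‖ := norm_pos_iff.2 hx
  rw [divergence_weightedField α hu.1 hx, divergence_pohozaevField hu.1]
  set r := ‖x‖ ^ (2 * α + 2) with hr
  set ρ := ‖x‖ ^ (-2 * α - 2) with hρ
  have hrρ : ρ * r = 1 := by
    rw [hr, hρ, ← Real.rpow_add hpos]
    ring_nf
    exact Real.rpow_zero _
  have hdiv : lap u x ^ 2 / ‖x‖ ^ (2 * α) = ρ * ‖x‖ ^ 2 * lap u x ^ 2 := by
    rw [hρ, ← norm_rpow_add_two hx, show -2 * α - 2 + 2 = -(2 * α) by ring,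
      Real.rpow_neg hpos.le]
    field_simp
  have hsq : 0 ≤ ρ * ∑ i, (2 * hessRadial u i x - lap u x * x i +
      (N - 2 - 2 * α + t * r) * partialDeriv i u x) ^ 2 :=
    mul_nonneg (by positivity) (Finset.sum_nonneg fun i _ => sq_nonneg _)
  have hexp : ∀ i, (2 * hessRadial u i x - lap u x * x i +
      (N - 2 - 2 * α + t * r) * partialDeriv i u x) ^ 2 =
      4 * (hessRadial u i x * hessRadial u i x) + lap u x ^ 2 * (x i * x i) +
      (N - 2 - 2 * α + t * r) ^ 2 * (partialDeriv i u x * partialDeriv i u x) +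
      -4 * lap u x * (x i * hessRadial u i x) +
      4 * (N - 2 - 2 * α + t * r) * (partialDeriv i u x * hessRadial u i x) +
      -2 * lap u x * (N - 2 - 2 * α + t * r) * (x i * partialDeriv i u x) := fun i => by ring
  simp only [hexp, Finset.sum_add_distrib, ← Finset.mul_sum] at hsq
  rw [← norm_sq_eq_sum_mul] at hsq
  have hQ : ∑ i, x i * partialDeriv i u x = eulerDeriv u x := rfl
  have hS : ∑ i, partialDeriv i u x * partialDeriv i u x = gradSq u x := rfl
  rw [hQ, hS] at hsq
  rw [hdiv]
  convert hsq using 1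
  linear_combination (-(t ^ 2 * r * gradSq u x) - t * (2 * (N - 2 - 2 * α) * gradSq u x +
    4 * ∑ i, partialDeriv i u x * hessRadial u i x - 2 * lap u x * eulerDeriv u x)) * hrρ

lemma nonneg_quadratic (α t : ℝ) (hu : IsTestFn u) :
    0 ≤ (∫ x, ‖x‖ ^ (2 * α + 2) * gradSq u x) * (t * t) +
      (-((N : ℝ) + 4 * α + 2) * ∫ x, gradSq u x) * t + ∫ x, lap u x ^ 2 / ‖x‖ ^ (2 * α) := by
  have hI : Integrable fun x => t ^ 2 * (‖x‖ ^ (2 * α + 2) * gradSq u x) :=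
    (hu.integrable (fun x h => by simp [gradSq_eq_zero h]) fun x hx =>
      (contDiffAt_norm_rpow _ hx).mul hu.1.gradSq.contDiffAt).const_mul _
  have hS : Integrable fun x => t * (-((N : ℝ) + 4 * α + 2) * gradSq u x) :=
    ((hu.integrable (fun x h => gradSq_eq_zero h)
      fun x _ => hu.1.gradSq.contDiffAt).const_mul _).const_mul _
  have hL : Integrable fun x => lap u x ^ 2 / ‖x‖ ^ (2 * α) :=
    hu.integrable (fun x h => by simp [lap_eq_zero h]) fun x hx =>
      (hu.1.lap.contDiffAt.pow 2).div (contDiffAt_norm_rpow _ hx)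
        (Real.rpow_pos_of_pos (norm_pos_iff.2 hx) _).ne'
  have hWs : ∀ i, ContDiff ℝ (⊤ : ℕ∞) (weightedField α u i) := fun i =>
    hu.contDiff (fun x => weightedField_eq_zero α i)
      fun x hx => contDiffAt_weightedField α hu.1 i hx
  have hWc : ∀ i, HasCompactSupport (weightedField α u i) := fun i =>
    hu.hasCompactSupport fun x => weightedField_eq_zero α i
  have hPs : ∀ i, ContDiff ℝ (⊤ : ℕ∞) (pohozaevField u i) := fun i =>
    contDiff_pohozaevField hu.1 i
  have hPc : ∀ i, HasCompactSupport (pohozaevField u i) := fun i =>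
    hu.hasCompactSupport fun x => pohozaevField_eq_zero i
  have h : 0 ≤ ∫ x, (t ^ 2 * (‖x‖ ^ (2 * α + 2) * gradSq u x) +
      t * (-((N : ℝ) + 4 * α + 2) * gradSq u x) + lap u x ^ 2 / ‖x‖ ^ (2 * α) +
      ∑ i, partialDeriv i (weightedField α u i) x +
      t * ∑ i, partialDeriv i (pohozaevField u i) x) :=
    integral_nonneg fun x => nonneg_quadratic_add_divergence α t hu x
  have hIS := hI.fun_add hS
  have hISL := hIS.fun_add hL
  rw [integral_add (hISL.fun_add (integrable_divergence hWs hWc))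
      ((integrable_divergence hPs hPc).const_mul t),
    integral_add hISL (integrable_divergence hWs hWc), integral_add hIS hL, integral_add hI hS,
    integral_divergence hWs hWc] at h
  simp only [integral_const_mul, integral_divergence hPs hPc] at h
  linarith

end TestFunctions

/-- the weighted second order Heisenberg Uncertainty Principle. -/
theorem weighted_second_order_HUP (N : ℕ) (hN : 1 ≤ N) (α : ℝ)
    (h : (0 < α + 1 ∧ 0 < (N : ℝ) - 2 * α ∧
            0 < (N : ℝ) - (Real.sqrt 5 - 1) * α - (Real.sqrt 5 + 1)) ∨
         ((N : ℝ) + 2 * α < 0 ∧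
            0 < (N : ℝ) + (Real.sqrt 5 + 1) * α + (Real.sqrt 5 - 1) ∧
            0 < (N : ℝ) - 2 * Real.sqrt 2 * α - 2 * Real.sqrt 2) ∨
         (α + 1 < 0 ∧ 0 < (N : ℝ) + 4 * α + 2))
    (u : EuclideanSpace ℝ (Fin N) → ℝ) (hu : IsTestFn u) :
    hupLHS N α u ≥ |(N : ℝ) + 4 * α + 2| / 2 * dirichlet N u := by
  simp only [hupLHS, dirichlet, norm_gradient_sq, sq_abs, ← Real.sqrt_eq_rpow]
  have hd := discrim_le_zero fun t => nonneg_quadratic α t hu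
  rw [discrim] at hd
  have hL : 0 ≤ ∫ x, lap u x ^ 2 / ‖x‖ ^ (2 * α) := integral_nonneg fun x => by positivity
  rw [ge_iff_le, ← Real.sqrt_mul hL]
  refine Real.le_sqrt_of_sq_le ?_
  rw [mul_pow, div_pow, sq_abs]
  linarith
end
end

section
/- Let N ≥ 1 be an integer and α ∈ ℝ, and suppose either (1) α + 1 > 0, N + 2α > 0 and 0 < (α+1)/(N+2α) < (√5 − 1)/4, or (2) α + 1 > 0, N + 2α < 0, (α+1)/(N+2α) < (−√5 − 1)/4 and (α+1)/(N+2α+2) < (√2 − 1)/2. Then the infimum over nonnegative integers k of [1 − 4k(2α+2)/(N+2k+2α)²] · (N+2k+4α+2)²/4 equals (N+4α+2)²/4. -/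
open Real

/-- The inequality between the `k`-th term and the `0`-th term reduces to the nonnegativity of a
cubic in `x = M + 2 k`. -/
lemma zeroth_le_term_of_cubic_nonneg {M b k x : ℝ} (hk : 0 ≤ k) (hx : x ≠ 0) (hxk : x = M + 2 * k)
    (hg : 0 ≤ x ^ 3 + M * x ^ 2 - 4 * b ^ 2 * x - 2 * b ^ 3) :
    (M + b) ^ 2 / 4 ≤ (1 - 4 * k * b / x ^ 2) * ((x + b) ^ 2 / 4) := by
  have key : (1 - 4 * k * b / x ^ 2) * ((x + b) ^ 2 / 4) - (M + b) ^ 2 / 4 =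
      2 * k * (x ^ 3 + M * x ^ 2 - 4 * b ^ 2 * x - 2 * b ^ 3) / (4 * x ^ 2) := by
    obtain rfl : M = x - 2 * k := by linarith
    field_simp
    ring
  have : 0 ≤ 2 * k * (x ^ 3 + M * x ^ 2 - 4 * b ^ 2 * x - 2 * b ^ 3) / (4 * x ^ 2) := by
    positivity
  linarith

lemma cubic_nonneg_of_pos {M b k : ℝ} (hM : 0 < M) (hb : 0 < b) (hk : 0 ≤ k)
    (hbM : b ^ 2 + b * M < M ^ 2) :
    0 ≤ (M + 2 * k) ^ 3 + M * (M + 2 * k) ^ 2 - 4 * b ^ 2 * (M + 2 * k) - 2 * b ^ 3 := by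
  have hsq : 0 ≤ 5 * M ^ 2 - 4 * b ^ 2 := by nlinarith [mul_pos hb hM]
  have h0 : 0 ≤ (M + b) * (M ^ 2 - b * M - b ^ 2) :=
    mul_nonneg (by linarith) (by linarith)
  have h1 : 0 ≤ k * (5 * M ^ 2 - 4 * b ^ 2) := mul_nonneg hk hsq
  have h2 : 0 ≤ M * k ^ 2 := by positivity
  have h3 : 0 ≤ k ^ 3 := by positivity
  linear_combination 2 * h0 + 2 * h1 + 16 * h2 + 8 * h3

lemma cubic_nonneg_of_one_le {b k : ℝ} (hb : 0 < b) (hk : 1 ≤ k) (hb2 : 2 * b ^ 2 < 1) :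
    0 ≤ (b - 1 + 2 * k) ^ 3 + (b - 1) * (b - 1 + 2 * k) ^ 2 - 4 * b ^ 2 * (b - 1 + 2 * k)
      - 2 * b ^ 3 := by
  obtain ⟨z, rfl⟩ : ∃ z, k = z + 1 := ⟨k - 1, by ring⟩
  have hz : 0 ≤ z := by linarith
  have h0 : 0 ≤ b * (1 - 2 * b ^ 2) := mul_nonneg hb.le (by linarith)
  have h1 : 0 ≤ z * (b ^ 2 + 6 * b + 1) := by positivity
  have h2 : 0 ≤ z ^ 2 * (4 * b + 2) := by positivity
  have h3 : 0 ≤ z ^ 3 := by positivity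
  linear_combination 2 * h0 + 2 * h1 + 4 * h2 + 8 * h3

/-- the infimum computation in Lemma 3.2. -/
theorem infimum_lemma_HUP (N : ℕ) (hN : 1 ≤ N) (α : ℝ)
    (h : (0 < α + 1 ∧ 0 < (N : ℝ) + 2 * α ∧
            0 < (α + 1) / ((N : ℝ) + 2 * α) ∧
            (α + 1) / ((N : ℝ) + 2 * α) < (Real.sqrt 5 - 1) / 4) ∨
         (0 < α + 1 ∧ (N : ℝ) + 2 * α < 0 ∧
            (α + 1) / ((N : ℝ) + 2 * α) < (-Real.sqrt 5 - 1) / 4 ∧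
            (α + 1) / ((N : ℝ) + 2 * α + 2) < (Real.sqrt 2 - 1) / 2)) :
    (⨅ k : ℕ, (1 - 4 * (k : ℝ) * (2 * α + 2) / ((N : ℝ) + 2 * (k : ℝ) + 2 * α) ^ 2) *
        (((N : ℝ) + 2 * (k : ℝ) + 4 * α + 2) ^ 2 / 4)) =
      ((N : ℝ) + 4 * α + 2) ^ 2 / 4 := by
  refine IsLeast.csInf_eq ⟨⟨0, by simp⟩, ?_⟩
  rintro _ ⟨k, rfl⟩
  rcases Nat.eq_zero_or_pos k with rfl | hkpos
  · simp
  have hk : (1 : ℝ) ≤ k := by exact_mod_cast hkpos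
  suffices hs : (N : ℝ) + 2 * k + 2 * α ≠ 0 ∧
      0 ≤ ((N : ℝ) + 2 * α + 2 * k) ^ 3 + (N + 2 * α) * (N + 2 * α + 2 * k) ^ 2
        - 4 * (2 * α + 2) ^ 2 * (N + 2 * α + 2 * k) - 2 * (2 * α + 2) ^ 3 by
    have hx : (N : ℝ) + 2 * k + 2 * α = N + 2 * α + 2 * k := by ring
    have := zeroth_le_term_of_cubic_nonneg (by linarith) (hx ▸ hs.1) rfl hs.2
    beta_reduce
    rwa [hx, show (N : ℝ) + 4 * α + 2 = N + 2 * α + (2 * α + 2) by ring,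
      show (N : ℝ) + 2 * k + 4 * α + 2 = N + 2 * α + 2 * k + (2 * α + 2) by ring]
  rcases h with ⟨hα, hM, -, ht⟩ | ⟨hα, hM, -, ht⟩
  · refine ⟨by linarith, cubic_nonneg_of_pos hM (by linarith) (by linarith) ?_⟩
    rw [div_lt_iff₀ hM] at ht
    have h5 : √5 ^ 2 = 5 := Real.sq_sqrt (by norm_num)
    have hlt : 2 * (2 * α + 2) + (N + 2 * α) < √5 * (N + 2 * α) := by linarith
    have := pow_lt_pow_left₀ hlt (by linarith) two_ne_zero
    rw [mul_pow, h5] at this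
    linarith
  · have hN1 : N = 1 := by
      have : (N : ℝ) < 2 := by linarith
      have : N < 2 := by exact_mod_cast this
      omega
    subst hN1
    push_cast at *
    rw [div_lt_iff₀ (by linarith)] at ht
    have h2 : √2 ^ 2 = 2 := Real.sq_sqrt (by norm_num)
    have h12 : √2 < 2 := by nlinarith [Real.sqrt_nonneg 2]
    have hb : 2 * (2 * α + 2) < √2 := by
      nlinarith
    have hsq := pow_lt_pow_left₀ hb (by linarith) two_ne_zero
    have hM' : 1 + 2 * α = 2 * α + 2 - 1 := by ring
    refine ⟨by linarith, ?_⟩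
    rw [hM']
    exact cubic_nonneg_of_one_le (by linarith) hk (by linarith)
end

section
/- Let N ≥ 1 be an integer and α ∈ ℝ, and suppose either (1) α + 1 > 0 and N − (√5 − 1)α − (√5 + 1) > 0, or (2) N + 2α < 0, N + (√5 + 1)α + (√5 − 1) > 0 and N − 2√2·α − 2√2 > 0. Then the infimum over nonnegative integers k of [1 − 4k(2α+2)/(N+2k+2α)²] · (N+2k+4α+2)²/4 equals (N+4α+2)²/4. -/
/-- With `A = N + 2α`, `c = 2α + 2` and `s = 2k`, the difference of the `k`-th and the zeroth value
is `s / (4 (A + s)²)` times a cubic polynomial. -/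
theorem value_ge_of_cubic_nonneg {A c s : ℝ} (hs : 0 ≤ s) (ht : A + s ≠ 0)
    (hP : 0 ≤ (A + s) ^ 3 + A * (A + s) ^ 2 - 4 * c ^ 2 * (A + s) - 2 * c ^ 3) :
    (A + c) ^ 2 / 4 ≤ (1 - 2 * s * c / (A + s) ^ 2) * ((A + s + c) ^ 2 / 4) := by
  have h : (1 - 2 * s * c / (A + s) ^ 2) * ((A + s + c) ^ 2 / 4) - (A + c) ^ 2 / 4 =
      s * ((A + s) ^ 3 + A * (A + s) ^ 2 - 4 * c ^ 2 * (A + s) - 2 * c ^ 3) /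
        (4 * (A + s) ^ 2) := by
    field_simp
    ring
  have : 0 ≤ s * ((A + s) ^ 3 + A * (A + s) ^ 2 - 4 * c ^ 2 * (A + s) - 2 * c ^ 3) /
        (4 * (A + s) ^ 2) := by positivity
  linarith

theorem cubic_nonneg_of_golden_lt {A c s : ℝ} (hc : 0 < c) (hs : 0 ≤ s)
    (hA : (Real.sqrt 5 + 1) / 2 * c < A) :
    0 ≤ (A + s) ^ 3 + A * (A + s) ^ 2 - 4 * c ^ 2 * (A + s) - 2 * c ^ 3 := by
  have h5 : Real.sqrt 5 ^ 2 = 5 := Real.sq_sqrt (by norm_num)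
  have h2 : 2 < Real.sqrt 5 := Real.lt_sqrt_of_sq_lt (by norm_num)
  have hcA : 3 / 2 * c < A := by nlinarith
  have hA0 : 0 < A := by linarith
  have hq : 0 ≤ A ^ 2 - A * c - c ^ 2 := by
    have : A ^ 2 - A * c - c ^ 2 =
        (A - (Real.sqrt 5 + 1) / 2 * c) * (A + (Real.sqrt 5 - 1) / 2 * c) := by
      linear_combination (c ^ 2 / 4) * h5
    rw [this]
    have : 0 < (Real.sqrt 5 - 1) / 2 * c := mul_pos (by linarith) hc
    exact mul_nonneg (by linarith) (by linarith)
  have hd : 0 ≤ 5 * A ^ 2 - 4 * c ^ 2 := by nlinarith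
  have : (A + s) ^ 3 + A * (A + s) ^ 2 - 4 * c ^ 2 * (A + s) - 2 * c ^ 3 =
      2 * ((A + c) * (A ^ 2 - A * c - c ^ 2)) + s * (5 * A ^ 2 - 4 * c ^ 2)
        + 4 * A * s ^ 2 + s ^ 3 := by ring
  rw [this]
  positivity

theorem cubic_nonneg_of_two_mul_sq_le_one {c u : ℝ} (hc : 0 < c) (hu : 0 ≤ u)
    (h : 2 * c ^ 2 ≤ 1) :
    0 ≤ (c + 1 + u) ^ 3 + (c - 1) * (c + 1 + u) ^ 2 - 4 * c ^ 2 * (c + 1 + u) - 2 * c ^ 3 := by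
  have h0 : 0 ≤ 1 - 2 * c ^ 2 := by linarith
  have : (c + 1 + u) ^ 3 + (c - 1) * (c + 1 + u) ^ 2 - 4 * c ^ 2 * (c + 1 + u) - 2 * c ^ 3 =
      2 * c * (1 - 2 * c ^ 2) + u * (c ^ 2 + 6 * c + 1) + u ^ 2 * (4 * c + 2) + u ^ 3 := by ring
  rw [this]
  positivity

/-- the infimum computation in Corollary 3.4. -/
theorem infimum_corollary_HUP (N : ℕ) (hN : 1 ≤ N) (α : ℝ)
    (h : (0 < α + 1 ∧ 0 < (N : ℝ) - (Real.sqrt 5 - 1) * α - (Real.sqrt 5 + 1)) ∨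
         ((N : ℝ) + 2 * α < 0 ∧
            0 < (N : ℝ) + (Real.sqrt 5 + 1) * α + (Real.sqrt 5 - 1) ∧
            0 < (N : ℝ) - 2 * Real.sqrt 2 * α - 2 * Real.sqrt 2)) :
    (⨅ k : ℕ, (1 - 4 * (k : ℝ) * (2 * α + 2) / ((N : ℝ) + 2 * (k : ℝ) + 2 * α) ^ 2) *
        (((N : ℝ) + 2 * (k : ℝ) + 4 * α + 2) ^ 2 / 4)) =
      ((N : ℝ) + 4 * α + 2) ^ 2 / 4 := by
  refine IsLeast.csInf_eq ⟨⟨0, by simp⟩, ?_⟩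
  rintro _ ⟨k, rfl⟩
  rcases Nat.eq_zero_or_pos k with rfl | hk
  · simp
  have hk1 : (1 : ℝ) ≤ k := by exact_mod_cast hk
  have hN1 : (1 : ℝ) ≤ N := by exact_mod_cast hN
  have key : N + 2 * α + 2 * (k : ℝ) ≠ 0 ∧
      0 ≤ (N + 2 * α + 2 * (k : ℝ)) ^ 3 + (N + 2 * α) * (N + 2 * α + 2 * (k : ℝ)) ^ 2
        - 4 * (2 * α + 2) ^ 2 * (N + 2 * α + 2 * (k : ℝ)) - 2 * (2 * α + 2) ^ 3 := by
    rcases h with ⟨hα, hφ⟩ | ⟨hneg, hφ, h2⟩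
    · have h5 : 0 ≤ Real.sqrt 5 := Real.sqrt_nonneg 5
      exact ⟨by linarith, cubic_nonneg_of_golden_lt (by linarith) (by linarith) (by linarith)⟩
    · have h1 : 1 < Real.sqrt 5 := Real.lt_sqrt_of_sq_lt (by norm_num)
      have hα : 0 < α + 1 := by
        by_contra hα
        nlinarith
      have hN2 : N = 1 := by
        have : (N : ℝ) < 2 := by linarith
        have : N < 2 := by exact_mod_cast this
        omega
      subst hN2
      push_cast at *
      have hs : Real.sqrt 2 ^ 2 = 2 := Real.sq_sqrt (by norm_num)
      have hsq : 2 * (2 * α + 2) ^ 2 ≤ 1 := by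
        have h0 : 0 ≤ Real.sqrt 2 * (2 * α + 2) :=
          mul_nonneg (Real.sqrt_nonneg 2) (by linarith)
        have : (Real.sqrt 2 * (2 * α + 2)) ^ 2 ≤ 1 := pow_le_one₀ h0 (by linarith)
        rwa [mul_pow, hs] at this
      have := cubic_nonneg_of_two_mul_sq_le_one (c := 2 * α + 2) (u := 2 * k - 2)
        (by linarith) (by linarith) hsq
      exact ⟨by linarith, by linear_combination this⟩
  have := value_ge_of_cubic_nonneg (by positivity : (0 : ℝ) ≤ 2 * k) key.1 key.2
  beta_reduce
  rw [show (N : ℝ) + 2 * k + 2 * α = N + 2 * α + 2 * k by ring]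
  linear_combination this
end
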